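/- Let Δ be an ice quiver and d ∈ ℤ^{Δ₀} a tropical A-point satisfying d·B_Δ^T = δ. Then for every seed t obtained from Δ by an arbitrary sequence of mutations at mutable vertices, one has d_t·B_{Δ_t}^T = δ_t, where d_t is obtained from d by the tropical A-point mutation rule, δ_t from δ by the Fock–Goncharov tropical δ-vector mutation rule, and B_{Δ_t} from B_Δ by Fomin–Zelevinsky matrix mutation. -/

import Mathlib

open scoped BigOperators

variable {V : Type} [Fintype V] [DecidableEq V]

/-- `[x]₊ = max(x, 0)`. -/
def intPos (x : ℤ) : ℤ := max x 0

/-- Fomin–Zelevinsky matrix mutation of the full skew-symmetric matrix `B(Δ)` at a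
(mutable) vertex `u` :  `b'_{vw} = −b_{vw}` if `u ∈ {v,w}` and
`b'_{vw} = b_{vw} + [b_{vu}]₊[b_{uw}]₊ − [−b_{vu}]₊[−b_{uw}]₊` otherwise. -/
def mutMatrix (B : V → V → ℤ) (u : V) : V → V → ℤ := fun v w =>
  if v = u ∨ w = u then - B v w
  else B v w + intPos (B v u) * intPos (B u w) - intPos (-(B v u)) * intPos (-(B u w))

/-- Mutation of a tropical `A`-point `d ∈ ℤ^{Δ₀}` at a (mutable) vertex `u` :
`d'(u) = −d(u) + max{ Σ_v d(v)[b_{vu}]₊ , Σ_v d(v)[−b_{vu}]₊ }` and `d'(v) = d(v)`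
for `v ≠ u`. -/
def mutTropA (B : V → V → ℤ) (u : V) (d : V → ℤ) : V → ℤ := fun v =>
  if v = u then
    - d u + max (∑ w, d w * intPos (B w u)) (∑ w, d w * intPos (-(B w u)))
  else d v

/-- Fock–Goncharov tropical mutation of a `δ`-vector at a (mutable) vertex `u` :
`δ'(u) = −δ(u)` and `δ'(v) = δ(v) + [b_{vu}]₊·δ(u) − b_{vu}·[δ(u)]₊` for `v ≠ u`. -/
def mutDelta (B : V → V → ℤ) (u : V) (δ : V → ℤ) : V → ℤ := fun v =>
  if v = u then - δ u
  else δ v + intPos (B v u) * δ u - B v u * intPos (δ u)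

/-- Simultaneous mutation of the triple `(B, d, δ)` along a sequence of vertices. -/
def mutSeq : List V → (V → V → ℤ) × (V → ℤ) × (V → ℤ) → (V → V → ℤ) × (V → ℤ) × (V → ℤ)
  | [], s => s
  | u :: us, (B, d, δ) => mutSeq us (mutMatrix B u, mutTropA B u d, mutDelta B u δ)

theorem mutMatrix_skew (B : V → V → ℤ) (hskew : ∀ v w, B w v = - B v w) (u : V) :
    ∀ v w, mutMatrix B u w v = - mutMatrix B u v w := by
  intro v w
  unfold mutMatrix
  by_cases hv : v = u
  · simp [hv, hskew u w]
  by_cases hw : w = u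
  · simp [hw, hskew u v]
  simp only [hv, hw, or_self, if_false]
  rw [hskew v w, hskew u w, hskew v u, neg_neg, neg_neg]
  ring

theorem pairing_step (mutV : V → Prop) (B : V → V → ℤ)
    (hskew : ∀ v w, B w v = - B v w) (d δ : V → ℤ)
    (h : ∀ u, mutV u → ∑ v, d v * B u v = δ u) (u : V) (hu : mutV u) :
    ∀ v, mutV v → ∑ w, mutTropA B u d w * mutMatrix B u v w = mutDelta B u δ v := by
  intro v hv
  have h0 : B u u = 0 := by have := hskew u u; omega
  by_cases hvu : v = u
  · subst hvu
    have : ∀ w, mutTropA B v d w * mutMatrix B v v w = - (d w * B v w) := by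
      intro w
      by_cases hw : w = v
      · subst hw; simp [mutMatrix, h0]
      · simp [mutMatrix, mutTropA, hw]
    simp only [this, Finset.sum_neg_distrib, h v hv, mutDelta, if_true]
  · have hδ : ∑ w, d w * intPos (-(B w u)) - ∑ w, d w * intPos (B w u) = δ u := by
      rw [← h u hu, ← Finset.sum_sub_distrib]
      refine Finset.sum_congr rfl fun w _ => ?_
      rw [hskew w u, ← mul_sub]
      congr 1
      unfold intPos
      omega
    have key : ∀ w, mutTropA B u d w * mutMatrix B u v w =
        d w * B v w + intPos (B v u) * (d w * intPos (-(B w u)))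
          - intPos (-(B v u)) * (d w * intPos (B w u))
          + if w = u then - (mutTropA B u d u * B v u) - d u * B v u else 0 := by
      intro w
      by_cases hw : w = u
      · subst hw
        simp [mutMatrix, h0, intPos]
      · simp only [mutMatrix, mutTropA, hw, hvu, or_self, if_false]
        rw [hskew w u, neg_neg]
        ring
    rw [Finset.sum_congr rfl fun w _ => key w]
    simp only [Finset.sum_add_distrib, Finset.sum_sub_distrib, ← Finset.mul_sum,
      Finset.sum_ite_eq', Finset.mem_univ, if_true, h v hv, mutDelta, hvu, if_false, mutTropA]
    generalize ∑ w, d w * intPos (-(B w u)) = N at *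
    generalize ∑ w, d w * intPos (B w u) = P at *
    have h1 : intPos (-(B v u)) = intPos (B v u) - B v u := by unfold intPos; omega
    have h2 : max P N = P + intPos (δ u) := by unfold intPos; omega
    rw [h1, h2, ← hδ]
    ring

/-- Lemma `L:mudB`.  Let `Δ` be an ice quiver with mutable vertices
`mutV` and skew-symmetric matrix `B(Δ)`, and let `d ∈ ℤ^{Δ₀}` be a tropical
`A`-point satisfying `d·B_Δᵀ = δ`, i.e. `Σ_v d(v)·B(u,v) = δ(u)` for every mutable
`u` (`B_Δ` being the rows of `B(Δ)` indexed by the mutable vertices).  Then for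
every seed `t` obtained from `Δ` by an arbitrary sequence of mutations at mutable
vertices one has `d_t·B_{Δ_t}ᵀ = δ_t`, where `d_t` is obtained from `d` by the
tropical `A`-point mutation rule, `δ_t` from `δ` by the Fock–Goncharov tropical
`δ`-vector mutation rule, and `B_{Δ_t}` from `B_Δ` by Fomin–Zelevinsky matrix
mutation. -/
theorem tropical_pairing_mutation_invariant
    (mutV : V → Prop) (B : V → V → ℤ)
    (hskew : ∀ v w, B w v = - B v w)
    (d δ : V → ℤ)
    (h : ∀ u, mutV u → ∑ v, d v * B u v = δ u)
    (us : List V) (hus : ∀ u ∈ us, mutV u) :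
    ∀ u, mutV u →
      ∑ v, (mutSeq us (B, d, δ)).2.1 v * (mutSeq us (B, d, δ)).1 u v
        = (mutSeq us (B, d, δ)).2.2 u := by
  induction us generalizing B d δ with
  | nil => exact h
  | cons a us ih =>
    have ha : mutV a := hus a (by simp)
    exact ih (mutMatrix B a) (mutMatrix_skew B hskew a) (mutTropA B a d) (mutDelta B a δ)
      (pairing_step mutV B hskew d δ h a ha) (fun u hu => hus u (by simp [hu]))
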